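/- Let A be a finite nonempty alphabet, l ≥ 1, and C ⊆ A^{Q_l} with Q_l = {0,…,l−1}². Let B* be the set of all strips u such that R_0(x) = u for some x ∈ X_C. Then every complementary family of admissible strips is contained in B*, and if B* is nonempty then B* is itself a complementary family; hence B* is the maximal complementary family. -/

import Mathlib

namespace SFT2

variable {A : Type*}

/-- The square `Q_l = {0,…,l−1}²` as a subset of `ℤ²`. -/
def Q (l : ℕ) : Set (ℤ × ℤ) :=
  {s | (0 ≤ s.1 ∧ s.1 < (l : ℤ)) ∧ (0 ≤ s.2 ∧ s.2 < (l : ℤ))}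

/-- A pattern `p : Q l → A` occurs in a function `x : T → A`:
there is `b ∈ ℤ²` with `b + Q l ⊆ T` such that `x (b + s) = p s` on `Q l`. -/
def OccursIn (l : ℕ) (p : Q l → A) (T : Set (ℤ × ℤ)) (x : T → A) : Prop :=
  ∃ b : ℤ × ℤ, ∃ h : ∀ s ∈ Q l, b + s ∈ T,
    ∀ s : Q l, x ⟨b + s.1, h s.1 s.2⟩ = p s

/-- A pattern `p : Q l → A` occurs in a full configuration `x : ℤ² → A`. -/
def OccursCfg (l : ℕ) (p : Q l → A) (x : ℤ × ℤ → A) : Prop :=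
  ∃ b : ℤ × ℤ, ∀ s : Q l, x (b + s.1) = p s

/-- The subshift of finite type determined by the forbidden set `C ⊆ A^{Q_l}`. -/
def XC (l : ℕ) (C : Set (Q l → A)) : Set (ℤ × ℤ → A) :=
  {x | ∀ p ∈ C, ¬ OccursCfg l p x}

/-- The domain `ℤ × {0,…,l−1}` of strips. -/
def StripDom (l : ℕ) : Set (ℤ × ℤ) := {s | 0 ≤ s.2 ∧ s.2 < (l : ℤ)}

/-- The domain `ℤ × {0,…,2l−1}` of stacks of two strips. -/
def StackDom (l : ℕ) : Set (ℤ × ℤ) := {s | 0 ≤ s.2 ∧ s.2 < 2 * (l : ℤ)}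

/-- The stack of two strips: `u` on rows `0,…,l−1` and `v` on rows `l,…,2l−1`. -/
def stack (l : ℕ) (u v : StripDom l → A) : StackDom l → A :=
  fun s =>
    if h : s.1.2 < (l : ℤ) then u ⟨s.1, ⟨s.2.1, h⟩⟩
    else v ⟨(s.1.1, s.1.2 - l), ⟨by have := s.2.1; omega, by have := s.2.2; omega⟩⟩

/-- A strip `u` is admissible if no pattern of `C` occurs in it. -/
def AdmissibleStrip (l : ℕ) (C : Set (Q l → A)) (u : StripDom l → A) : Prop :=
  ∀ p ∈ C, ¬ OccursIn l p (StripDom l) u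

/-- `(u,v)` is an admissible pair if no pattern of `C` occurs in `stack u v`. -/
def AdmissiblePair (l : ℕ) (C : Set (Q l → A)) (u v : StripDom l → A) : Prop :=
  ∀ p ∈ C, ¬ OccursIn l p (StackDom l) (stack l u v)

/-- The `n`-th strip of a configuration: `R_n(x)(i,j) = x(i, n·l + j)`. -/
def R (l : ℕ) (x : ℤ × ℤ → A) (n : ℤ) : StripDom l → A :=
  fun s => x (s.1.1, n * l + s.1.2)

/-- A family `B` of admissible strips is complementary if every `u ∈ B` has
`v, w ∈ B` with `(u,v)` and `(w,u)` admissible pairs. -/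
def Complementary (l : ℕ) (C : Set (Q l → A)) (B : Set (StripDom l → A)) : Prop :=
  (∀ u ∈ B, AdmissibleStrip l C u) ∧
    ∀ u ∈ B, (∃ v ∈ B, AdmissiblePair l C u v) ∧ ∃ w ∈ B, AdmissiblePair l C w u

end SFT2

namespace SFT2

theorem stack_R {A : Type*} (l : ℕ) (x : ℤ × ℤ → A) (n : ℤ) (s : StackDom l) :
    stack l (R l x n) (R l x (n + 1)) s = x (s.1.1, n * l + s.1.2) := by
  unfold stack R
  split_ifs
  · rfl
  · exact congrArg x (Prod.ext rfl (by ring))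

/-- Membership in the subshift is a condition on pairs of consecutive strips. -/
theorem mem_XC_iff_admissiblePair {A : Type*} {l : ℕ} (hl : 1 ≤ l) (C : Set (Q l → A))
    (x : ℤ × ℤ → A) :
    x ∈ XC l C ↔ ∀ n, AdmissiblePair l C (R l x n) (R l x (n + 1)) := by
  constructor
  · rintro hx n p hp ⟨b, h, hb⟩
    refine hx p hp ⟨(b.1, n * l + b.2), fun s => ?_⟩
    rw [← hb s, stack_R]
    exact congrArg x (Prod.ext rfl (add_assoc _ _ _))
  · rintro hx p hp ⟨b, hb⟩
    have hl0 : (0 : ℤ) < l := by exact_mod_cast hl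
    have hnonneg := Int.emod_nonneg b.2 hl0.ne'
    have hlt := Int.emod_lt_of_pos b.2 hl0
    refine hx (b.2 / l) p hp ⟨(b.1, b.2 % l), fun s hs => ?_, fun s => ?_⟩
    · obtain ⟨_, h0, h1⟩ := hs
      exact ⟨add_nonneg hnonneg h0, by
        change b.2 % l + s.2 < 2 * (l : ℤ)
        linarith⟩
    · rw [stack_R, ← hb s]
      refine congrArg x (Prod.ext rfl ?_)
      change b.2 / l * l + (b.2 % l + s.1.2) = b.2 + s.1.2
      rw [← add_assoc, Int.ediv_mul_add_emod]

theorem admissibleStrip_R {A : Type*} {l : ℕ} {C : Set (Q l → A)} {x : ℤ × ℤ → A}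
    (hx : x ∈ XC l C) (n : ℤ) : AdmissibleStrip l C (R l x n) := by
  rintro p hp ⟨b, h, hb⟩
  refine hx p hp ⟨(b.1, n * l + b.2), fun s => ?_⟩
  rw [← hb s]
  exact congrArg x (Prod.ext rfl (add_assoc _ _ _))

theorem exists_R_zero_eq_R {A : Type*} {l : ℕ} {C : Set (Q l → A)} {x : ℤ × ℤ → A}
    (hx : x ∈ XC l C) (n : ℤ) : ∃ y ∈ XC l C, R l y 0 = R l x n := by
  refine ⟨fun s => x (s.1, n * l + s.2), ?_, ?_⟩
  · rintro p hp ⟨b, hb⟩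
    refine hx p hp ⟨(b.1, n * l + b.2), fun s => ?_⟩
    rw [← hb s]
    exact congrArg x (Prod.ext rfl (add_assoc _ _ _))
  · funext s
    simp [R]

/-- The configuration whose `n`-th strip is `U n`. -/
theorem exists_forall_R_eq {A : Type*} {l : ℕ} (hl : 1 ≤ l) (U : ℤ → StripDom l → A) :
    ∃ x : ℤ × ℤ → A, ∀ n, R l x n = U n := by
  have hl0 : (0 : ℤ) < l := by exact_mod_cast hl
  refine ⟨fun s => U (s.2 / l) ⟨(s.1, s.2 % l), Int.emod_nonneg _ hl0.ne',
    Int.emod_lt_of_pos _ hl0⟩, fun n => ?_⟩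
  funext s
  obtain ⟨⟨i, j⟩, h0, h1⟩ := s
  have hdiv : (n * l + j) / (l : ℤ) = n := by
    rw [add_comm, Int.add_mul_ediv_right _ _ hl0.ne', Int.ediv_eq_zero_of_lt h0 h1, zero_add]
  have hmod : (n * l + j) % (l : ℤ) = j := by
    rw [add_comm, Int.add_mul_emod_self_right, Int.emod_eq_of_lt h0 h1]
  simp only [R, hdiv, hmod]

/-- A relation that is total in both directions admits bi-infinite chains through any point. -/
theorem exists_int_chain {α : Type*} {r : α → α → Prop} (hr : ∀ a, ∃ b, r a b)
    (hl : ∀ a, ∃ b, r b a) (a : α) : ∃ U : ℤ → α, U 0 = a ∧ ∀ n, r (U n) (U (n + 1)) := by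
  choose f hf using hr
  choose g hg using hl
  refine ⟨fun n => if 0 ≤ n then f^[n.toNat] a else g^[(-n).toNat] a, by simp, fun n => ?_⟩
  rcases le_or_gt 0 n with h | h
  · simp only [h, show 0 ≤ n + 1 by omega, if_true, show (n + 1).toNat = n.toNat + 1 by omega,
      Function.iterate_succ_apply']
    exact hf _
  · have hrec : g^[(-n).toNat] a = g (g^[(-(n + 1)).toNat] a) := by
      rw [← Function.iterate_succ_apply' g, show (-n).toNat = (-(n + 1)).toNat.succ by omega]
    have hsucc : (if 0 ≤ n + 1 then f^[(n + 1).toNat] a else g^[(-(n + 1)).toNat] a) =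
        g^[(-(n + 1)).toNat] a := by
      split_ifs with h'
      · obtain rfl : n = -1 := by omega
        rfl
      · rfl
    simp only [hsucc, if_neg h.not_ge, hrec]
    exact hg _

end SFT2


/-- let `B*` be the set of strips of the form `R_0(x)` for `x ∈ X_C`.
Every complementary family of admissible strips is contained in `B*`, and if `B*`
is nonempty then `B*` is itself a complementary family (hence maximal). -/
theorem stmt6 {A : Type*} [Finite A] [Nonempty A] (l : ℕ) (hl : 1 ≤ l)
    (C : Set (SFT2.Q l → A)) :
    (∀ B : Set (SFT2.StripDom l → A), SFT2.Complementary l C B →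
        B ⊆ {u | ∃ x ∈ SFT2.XC l C, SFT2.R l x 0 = u}) ∧
      ({u | ∃ x ∈ SFT2.XC l C, SFT2.R l x 0 = u}.Nonempty →
        SFT2.Complementary l C {u | ∃ x ∈ SFT2.XC l C, SFT2.R l x 0 = u}) := by
  refine ⟨fun B hB u hu => ?_, fun _ => ⟨?_, ?_⟩⟩
  · obtain ⟨U, hU0, hU⟩ := SFT2.exists_int_chain
      (r := fun a b : B => SFT2.AdmissiblePair l C a.1 b.1)
      (fun a => let ⟨v, hv, h⟩ := (hB.2 a.1 a.2).1; ⟨⟨v, hv⟩, h⟩)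
      (fun a => let ⟨w, hw, h⟩ := (hB.2 a.1 a.2).2; ⟨⟨w, hw⟩, h⟩) ⟨u, hu⟩
    obtain ⟨x, hx⟩ := SFT2.exists_forall_R_eq hl fun n => (U n).1
    refine ⟨x, (SFT2.mem_XC_iff_admissiblePair hl C x).2 fun n => ?_, ?_⟩
    · rw [hx, hx]
      exact hU n
    · rw [hx, hU0]
  · rintro _ ⟨x, hx, rfl⟩
    exact SFT2.admissibleStrip_R hx 0
  · rintro _ ⟨x, hx, rfl⟩
    have hpair := (SFT2.mem_XC_iff_admissiblePair hl C x).1 hx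
    exact ⟨⟨_, SFT2.exists_R_zero_eq_R hx 1, hpair 0⟩,
      ⟨_, SFT2.exists_R_zero_eq_R hx (-1), hpair (-1)⟩⟩
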